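/- Let σ > 0 and 0 ≤ τ < σ. If an irrational x ∈ (0,1) is Diophantine of exponent τ, i.e. there exists γ > 0 such that |x − p/q| ≥ γ/q^{2+τ} for all integers p and all positive integers q, then B_σ(x) < +∞ (x is a σ-Brjuno number). -/

import Mathlib

open Real Set MeasureTheory
open scoped ENNReal

/-- The Gauss map `A(x) = 1/x - ⌊1/x⌋`. -/
noncomputable def gaussMap (x : ℝ) : ℝ := 1 / x - (⌊1 / x⌋ : ℝ)

/-- `brjunoBeta x j = β_{j-1}(x) = ∏_{i=0}^{j-1} A^i(x)`; in particular
`brjunoBeta x 0 = β_{-1}(x) = 1` and `β_K(x) = brjunoBeta x (K+1)`. -/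
noncomputable def brjunoBeta (x : ℝ) (j : ℕ) : ℝ := ∏ i ∈ Finset.range j, gaussMap^[i] x

/-- The σ-Brjuno function `B_σ(x) = Σ_{j≥0} β_{j-1}(x) · (A^j x)^{-1/σ}`, valued in `[0,+∞]`. -/
noncomputable def brjuno (σ x : ℝ) : ℝ≥0∞ :=
  ∑' j : ℕ, ENNReal.ofReal (brjunoBeta x j * (gaussMap^[j] x) ^ (-(1 / σ)))

/-- The K-th partial sum `B_σ^{(K)}(x) = Σ_{j=0}^{K} β_{j-1}(x) · (A^j x)^{-1/σ}`. -/
noncomputable def brjunoPartial (σ x : ℝ) (K : ℕ) : ℝ :=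
  ∑ j ∈ Finset.range (K + 1), brjunoBeta x j * (gaussMap^[j] x) ^ (-(1 / σ))

/-- The fixed point `η_m = (√(m²+4) − m)/2 = [0; m, m, m, ...]` of the Gauss map. -/
noncomputable def eta (m : ℕ) : ℝ := (Real.sqrt ((m : ℝ) ^ 2 + 4) - m) / 2

/-- `b* = (σ+1)^{1+1/σ}/σ`. -/
noncomputable def bstar (σ : ℝ) : ℝ := (σ + 1) ^ (1 + 1 / σ) / σ

/-- The global lower bound `g(x) = x^{-1/σ} + b*·x`. -/
noncomputable def gLow (σ x : ℝ) : ℝ := x ^ (-(1 / σ)) + bstar σ * x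

/-- The cylinder lower bound `g_k(x) = x^{-1/σ} + x·(1/x − k)^{-1/σ} + (1 − kx)·b*`. -/
noncomputable def gCyl (σ : ℝ) (k : ℕ) (x : ℝ) : ℝ :=
  x ^ (-(1 / σ)) + x * (1 / x - (k : ℝ)) ^ (-(1 / σ)) + (1 - (k : ℝ) * x) * bstar σ
lemma gaussMap_eq_fract (x : ℝ) : gaussMap x = Int.fract (1 / x) := rfl

lemma Irrational.gaussMap {x : ℝ} (hx : Irrational x) : Irrational (gaussMap x) := by
  have h : Irrational (1 / x) := by simpa using hx.inv
  exact h.sub_intCast _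

lemma Irrational.gaussMap_mem_Ioo {x : ℝ} (hx : Irrational x) :
    _root_.gaussMap x ∈ Ioo (0 : ℝ) 1 := by
  refine ⟨lt_of_le_of_ne ?_ hx.gaussMap.ne_zero.symm, ?_⟩
  · rw [gaussMap_eq_fract]; exact Int.fract_nonneg _
  · rw [gaussMap_eq_fract]; exact Int.fract_lt_one _

lemma irrational_gaussMap_iterate {x : ℝ} (hx : Irrational x) (n : ℕ) :
    Irrational (gaussMap^[n] x) := by
  induction n with
  | zero => exact hx
  | succ n ih => rw [Function.iterate_succ_apply']; exact ih.gaussMap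

lemma gaussMap_iterate_mem_Ioo {x : ℝ} (hx : Irrational x) (hx01 : x ∈ Ioo (0 : ℝ) 1) (n : ℕ) :
    gaussMap^[n] x ∈ Ioo (0 : ℝ) 1 := by
  cases n with
  | zero => exact hx01
  | succ n =>
    rw [Function.iterate_succ_apply']
    exact (irrational_gaussMap_iterate hx n).gaussMap_mem_Ioo

lemma brjunoBeta_succ (x : ℝ) (n : ℕ) :
    brjunoBeta x (n + 1) = brjunoBeta x n * gaussMap^[n] x :=
  Finset.prod_range_succ _ _

lemma brjunoBeta_pos {x : ℝ} (hx : Irrational x) (hx01 : x ∈ Ioo (0 : ℝ) 1) (n : ℕ) :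
    0 < brjunoBeta x n :=
  Finset.prod_pos fun i _ => (gaussMap_iterate_mem_Ioo hx hx01 i).1

/-- The products `β` satisfy a two-term linear recurrence whose coefficients are the partial
quotients. -/
lemma exists_brjunoBeta_add_two {x : ℝ} (hx : Irrational x) (hx01 : x ∈ Ioo (0 : ℝ) 1) (n : ℕ) :
    ∃ a : ℕ, 0 < a ∧ brjunoBeta x (n + 2) = brjunoBeta x n - a * brjunoBeta x (n + 1) := by
  obtain ⟨h0, h1⟩ := gaussMap_iterate_mem_Ioo hx hx01 n
  have hfloor : 1 ≤ ⌊1 / gaussMap^[n] x⌋ := by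
    rw [Int.le_floor, Int.cast_one, le_div_iff₀ h0]
    linarith
  obtain ⟨a, ha⟩ := Int.eq_ofNat_of_zero_le (zero_le_one.trans hfloor)
  refine ⟨a, by omega, ?_⟩
  rw [brjunoBeta_succ, brjunoBeta_succ, Function.iterate_succ_apply', gaussMap, ha]
  push_cast
  field_simp

lemma brjunoBeta_add_two_le {x : ℝ} (hx : Irrational x) (hx01 : x ∈ Ioo (0 : ℝ) 1) (n : ℕ) :
    brjunoBeta x (n + 2) ≤ brjunoBeta x n / 2 := by
  obtain ⟨a, ha, hrec⟩ := exists_brjunoBeta_add_two hx hx01 n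
  have ha1 : (1 : ℝ) ≤ a := by exact_mod_cast ha
  have hpos := brjunoBeta_pos hx hx01 (n + 1)
  have hle : brjunoBeta x (n + 2) ≤ brjunoBeta x (n + 1) := by
    rw [brjunoBeta_succ]
    exact mul_le_of_le_one_right hpos.le (gaussMap_iterate_mem_Ioo hx hx01 (n + 1)).2.le
  nlinarith

lemma brjunoBeta_sq_le {x : ℝ} (hx : Irrational x) (hx01 : x ∈ Ioo (0 : ℝ) 1) (n : ℕ) :
    brjunoBeta x n ^ 2 ≤ 2 * (1 / 2) ^ n := by
  induction n using Nat.twoStepInduction with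
  | zero => norm_num [brjunoBeta]
  | one =>
    obtain ⟨h0, h1⟩ := hx01
    simp [brjunoBeta]
    exact abs_le.2 ⟨by linarith, h1.le⟩
  | more n ih _ =>
    have h := brjunoBeta_add_two_le hx hx01 n
    have hpos := brjunoBeta_pos hx hx01 (n + 2)
    calc brjunoBeta x (n + 2) ^ 2 ≤ (brjunoBeta x n / 2) ^ 2 := by gcongr
      _ = brjunoBeta x n ^ 2 / 4 := by ring
      _ ≤ 2 * (1 / 2) ^ n / 4 := by gcongr
      _ = 2 * (1 / 2) ^ (n + 2) := by ring

/-- The products `β` are, up to sign, the errors `p - q x` of consecutive convergents. -/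
lemma exists_convergents_brjunoBeta {x : ℝ} (hx : Irrational x) (hx01 : x ∈ Ioo (0 : ℝ) 1)
    (n : ℕ) :
    ∃ (ε : ℝ) (p p' : ℤ) (q q' : ℕ), |ε| = 1 ∧ 0 < q' ∧
      brjunoBeta x n = ε * (p - q * x) ∧ brjunoBeta x (n + 1) = -ε * (p' - q' * x) ∧
      q' * brjunoBeta x n + q * brjunoBeta x (n + 1) = 1 := by
  induction n with
  | zero => exact ⟨1, 1, 0, 0, 1, by simp, by simp, by simp [brjunoBeta], by simp [brjunoBeta],
      by simp [brjunoBeta]⟩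
  | succ n ih =>
    obtain ⟨ε, p, p', q, q', hε, hq', hp, hp', hdet⟩ := ih
    obtain ⟨a, ha, hrec⟩ := exists_brjunoBeta_add_two hx hx01 n
    refine ⟨-ε, p', p + a * p', q', q + a * q', by rwa [abs_neg], by positivity, hp', ?_, ?_⟩
    · rw [hrec, hp, hp']; push_cast; ring
    · rw [hrec]; push_cast; linear_combination hdet

lemma exists_convergent_brjunoBeta {x : ℝ} (hx : Irrational x) (hx01 : x ∈ Ioo (0 : ℝ) 1)
    (n : ℕ) :
    ∃ (p : ℤ) (q : ℕ), 0 < q ∧ q * brjunoBeta x n ≤ 1 ∧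
      brjunoBeta x (n + 1) = q * |x - p / q| := by
  obtain ⟨ε, -, p', q, q', hε, hq', -, hp', hdet⟩ := exists_convergents_brjunoBeta hx hx01 n
  have hpos := brjunoBeta_pos hx hx01 (n + 1)
  refine ⟨p', q', hq', ?_, ?_⟩
  · have : 0 ≤ (q : ℝ) * brjunoBeta x (n + 1) := by positivity
    linarith
  · have hq : (0 : ℝ) < q' := by exact_mod_cast hq'
    rw [← abs_of_pos hpos, hp', abs_mul, abs_neg, hε, one_mul, abs_sub_comm]
    nth_rewrite 2 [← abs_of_pos hq]
    rw [← abs_mul]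
    congr 1
    field_simp

/-- A Diophantine condition bounds the Gauss orbit from below by a power of `β`. -/
lemma le_gaussMap_iterate_of_diophantine {x τ γ : ℝ} (hx : Irrational x)
    (hx01 : x ∈ Ioo (0 : ℝ) 1) (hτ : 0 ≤ τ) (hγ : 0 < γ)
    (hdio : ∀ (p : ℤ) (q : ℕ), 0 < q →
      γ / (q : ℝ) ^ ((2 : ℝ) + τ) ≤ |x - (p : ℝ) / (q : ℝ)|) (n : ℕ) :
    γ * brjunoBeta x n ^ τ ≤ gaussMap^[n] x := by
  obtain ⟨p, q, hq, hqβ, heq⟩ := exists_convergent_brjunoBeta hx hx01 n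
  have hβ := brjunoBeta_pos hx hx01 n
  have hq0 : (0 : ℝ) < q := by exact_mod_cast hq
  refine le_of_mul_le_mul_left ?_ hβ
  rw [← brjunoBeta_succ, heq]
  calc brjunoBeta x n * (γ * brjunoBeta x n ^ τ) = γ * brjunoBeta x n ^ (1 + τ) := by
        rw [rpow_add hβ, rpow_one]; ring
    _ ≤ γ * (1 / q : ℝ) ^ (1 + τ) := by
        gcongr
        rw [le_div_iff₀ hq0]
        linarith
    _ = q * (γ / (q : ℝ) ^ ((2 : ℝ) + τ)) := by
        rw [one_div, inv_rpow hq0.le, show (2 : ℝ) + τ = 1 + (1 + τ) by ring,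
          rpow_add hq0 1 (1 + τ), rpow_one]
        field_simp
    _ ≤ q * |x - p / q| := by gcongr; exact hdio p q hq

lemma summable_brjunoBeta_rpow {x s : ℝ} (hx : Irrational x) (hx01 : x ∈ Ioo (0 : ℝ) 1)
    (hs : 0 < s) : Summable fun n => brjunoBeta x n ^ s := by
  have hr : ((1 / 2 : ℝ)) ^ (s / 2) < 1 :=
    rpow_lt_one (by norm_num) (by norm_num) (by positivity)
  refine Summable.of_nonneg_of_le (fun n => rpow_nonneg (brjunoBeta_pos hx hx01 n).le _)
    (fun n => ?_) ((summable_geometric_of_lt_one (by positivity) hr).mul_left (2 ^ (s / 2)))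
  have hβ := brjunoBeta_pos hx hx01 n
  calc brjunoBeta x n ^ s = (brjunoBeta x n ^ 2) ^ (s / 2) := by
        rw [← rpow_natCast, ← rpow_mul hβ.le]; congr 1; push_cast; ring
    _ ≤ (2 * (1 / 2) ^ n) ^ (s / 2) := by
        gcongr
        exact brjunoBeta_sq_le hx hx01 n
    _ = 2 ^ (s / 2) * ((1 / 2) ^ (s / 2)) ^ n := by
        rw [mul_rpow (by norm_num) (by positivity), ← rpow_natCast, ← rpow_natCast,
          ← rpow_mul (by norm_num), ← rpow_mul (by norm_num), mul_comm (n : ℝ)]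

/-- Diophantine numbers of exponent `τ < σ` are σ-Brjuno numbers. -/
theorem diophantine_implies_brjuno (σ τ : ℝ) (hσ : 0 < σ) (hτ : 0 ≤ τ) (hτσ : τ < σ)
    (x : ℝ) (hx : Irrational x) (hx01 : x ∈ Set.Ioo (0 : ℝ) 1)
    (hdio : ∃ γ : ℝ, 0 < γ ∧ ∀ (p : ℤ) (q : ℕ), 0 < q →
      γ / (q : ℝ) ^ ((2 : ℝ) + τ) ≤ |x - (p : ℝ) / (q : ℝ)|) :
    brjuno σ x < ⊤ := by
  obtain ⟨γ, hγ, hdio⟩ := hdio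
  have hs : 0 < 1 - τ / σ := sub_pos.2 ((div_lt_one hσ).2 hτσ)
  have hsum : Summable fun n => brjunoBeta x n * (gaussMap^[n] x) ^ (-(1 / σ)) := by
    refine Summable.of_nonneg_of_le
      (fun n => mul_nonneg (brjunoBeta_pos hx hx01 n).le
        (rpow_nonneg (gaussMap_iterate_mem_Ioo hx hx01 n).1.le _))
      (fun n => ?_) ((summable_brjunoBeta_rpow hx hx01 hs).mul_left (γ ^ (-(1 / σ))))
    have hβ := brjunoBeta_pos hx hx01 n
    calc brjunoBeta x n * (gaussMap^[n] x) ^ (-(1 / σ))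
        ≤ brjunoBeta x n * (γ * brjunoBeta x n ^ τ) ^ (-(1 / σ)) := by
          refine mul_le_mul_of_nonneg_left (rpow_le_rpow_of_nonpos (by positivity)
            (le_gaussMap_iterate_of_diophantine hx hx01 hτ hγ hdio n) ?_) hβ.le
          exact neg_nonpos.2 (by positivity)
      _ = γ ^ (-(1 / σ)) * brjunoBeta x n ^ (1 - τ / σ) := by
          rw [mul_rpow hγ.le (by positivity), ← rpow_mul hβ.le,
            show 1 - τ / σ = 1 + τ * -(1 / σ) by ring, rpow_add hβ, rpow_one]
          ring
  exact hsum.tsum_ofReal_lt_top
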